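/- Every Schützenberger group of a strongly subsemigroup separable semigroup is itself strongly subsemigroup separable: if S is strongly subsemigroup separable and H is an H-class of S, then the Schützenberger group Γ(H), viewed as a semigroup, is strongly subsemigroup separable. -/

import Mathlib

open scoped Pointwise

/-- A semigroup is residually finite if distinct points can be distinguished in a
finite semigroup quotient (image). -/
def IsResiduallyFiniteSemigroup (S : Type*) [Semigroup S] : Prop :=
  ∀ s t : S, s ≠ t →
    ∃ (U : Type) (_ : Semigroup U) (_ : Finite U) (f : S →ₙ* U), f s ≠ f t

/-- A semigroup is weakly subsemigroup separable if every element outside a finitely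
generated subsemigroup can be separated from it in a finite semigroup image. -/
def IsWeaklySubsemigroupSeparable (S : Type*) [Semigroup S] : Prop :=
  ∀ T : Subsemigroup S, (∃ Y : Finset S, T = Subsemigroup.closure (Y : Set S)) →
    ∀ s : S, s ∉ T →
      ∃ (U : Type) (_ : Semigroup U) (_ : Finite U) (f : S →ₙ* U),
        f s ∉ f '' (T : Set S)

/-- A semigroup is strongly subsemigroup separable if every element outside a
subsemigroup can be separated from it in a finite semigroup image. -/
def IsStronglySubsemigroupSeparable (S : Type*) [Semigroup S] : Prop :=
  ∀ T : Subsemigroup S, ∀ s : S, s ∉ T →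
    ∃ (U : Type) (_ : Semigroup U) (_ : Finite U) (f : S →ₙ* U),
      f s ∉ f '' (T : Set S)

/-- A semigroup is completely separable if every element can be separated from its
complement in a finite semigroup image. -/
def IsCompletelySeparable (S : Type*) [Semigroup S] : Prop :=
  ∀ s : S,
    ∃ (U : Type) (_ : Semigroup U) (_ : Finite U) (f : S →ₙ* U),
      f s ∉ f '' {t : S | t ≠ s}

/-- A semigroup is locally finite if every finitely generated subsemigroup is finite. -/
def IsLocallyFiniteSemigroup (S : Type*) [Semigroup S] : Prop :=
  ∀ Y : Finset S, ((Subsemigroup.closure (Y : Set S) : Subsemigroup S) : Set S).Finite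

/-- A group is weakly subgroup separable (LERF) if every element outside a finitely
generated subgroup can be separated from it in a finite group image. -/
def IsWeaklySubgroupSeparable (G : Type*) [Group G] : Prop :=
  ∀ H : Subgroup G, H.FG → ∀ g : G, g ∉ H →
    ∃ (K : Type) (_ : Group K) (_ : Finite K) (f : G →* K),
      f g ∉ f '' (H : Set G)

/-- A group is strongly subgroup separable (ERF) if every element outside a subgroup
can be separated from it in a finite group image. -/
def IsStronglySubgroupSeparable (G : Type*) [Group G] : Prop :=
  ∀ H : Subgroup G, ∀ g : G, g ∉ H →
    ∃ (K : Type) (_ : Group K) (_ : Finite K) (f : G →* K),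
      f g ∉ f '' (H : Set G)

/-- Green's relation H: x H y iff xS¹ = yS¹ and S¹x = S¹y. -/
def GreenH {S : Type*} [Semigroup S] (x y : S) : Prop :=
  insert x {z : S | ∃ s : S, z = x * s} = insert y {z : S | ∃ s : S, z = y * s} ∧
  insert x {z : S | ∃ s : S, z = s * x} = insert y {z : S | ∃ s : S, z = s * y}

/-- The H-class of an element. -/
def HClass {S : Type*} [Semigroup S] (x : S) : Set S := {y : S | GreenH x y}

/-- The n-fold pointwise product A·A⋯A (for n ≥ 1; we set the value at 0 to be A). -/
def SetNPow {S : Type*} [Semigroup S] (A : Set S) : ℕ → Set S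
  | 0 => A
  | 1 => A
  | n + 2 => SetNPow A (n + 1) * A

/-- The right stabiliser Stab(H) = {s ∈ S¹ | Hs = H}, a submonoid of S¹ = WithOne S. -/
def SchStab {S : Type*} [Semigroup S] (H : Set S) : Submonoid (WithOne S) where
  carrier := {s : WithOne S |
    (fun h => h * s) '' ((fun x : S => (x : WithOne S)) '' H)
      = (fun x : S => (x : WithOne S)) '' H}
  one_mem' := by
    simp only [Set.mem_setOf_eq, mul_one, Set.image_id']
  mul_mem' := by
    intro a b ha hb
    simp only [Set.mem_setOf_eq] at ha hb ⊢
    have hcomp : (fun h : WithOne S => h * (a * b))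
        = (fun h : WithOne S => h * b) ∘ fun h : WithOne S => h * a := by
      funext h; simp [mul_assoc]
    rw [hcomp, Set.image_comp, ha, hb]

/-- `(Γ, φ)` realises the Schützenberger group of the H-class `H`: `φ` is a surjective
monoid homomorphism from `Stab(H)` onto the group `Γ` whose kernel relation is exactly
the Schützenberger congruence `σ_H`. -/
def IsSchutzenbergerGroup {S : Type*} [Semigroup S] (H : Set S) (Γ : Type*) [Group Γ]
    (φ : SchStab H →* Γ) : Prop :=
  Function.Surjective φ ∧
    ∀ a b : SchStab H,
      φ a = φ b ↔ ∀ h ∈ H,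
        (h : WithOne S) * (a : WithOne S) = (h : WithOne S) * (b : WithOne S)

lemma insert_right_multiples_eq {S : Type*} [Semigroup S] (x : S) :
    insert x {z : S | ∃ s : S, z = x * s}
      = {z : S | ∃ u : WithOne S, (z : WithOne S) = x * u} := by
  ext z
  constructor
  · rintro (rfl | ⟨s, rfl⟩)
    · exact ⟨1, by simp⟩
    · exact ⟨s, by simp⟩
  · rintro ⟨u, hu⟩
    cases u with
    | one => exact Or.inl (by simpa using hu)
    | coe s => exact Or.inr ⟨s, by exact_mod_cast hu⟩

lemma insert_left_multiples_eq {S : Type*} [Semigroup S] (x : S) :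
    insert x {z : S | ∃ s : S, z = s * x}
      = {z : S | ∃ u : WithOne S, (z : WithOne S) = u * x} := by
  ext z
  constructor
  · rintro (rfl | ⟨s, rfl⟩)
    · exact ⟨1, by simp⟩
    · exact ⟨s, by simp⟩
  · rintro ⟨u, hu⟩
    cases u with
    | one => exact Or.inl (by simpa using hu)
    | coe s => exact Or.inr ⟨s, by exact_mod_cast hu⟩

lemma greenH_iff {S : Type*} [Semigroup S] (x y : S) :
    GreenH x y ↔
      ((∃ u : WithOne S, (y : WithOne S) = x * u) ∧ ∃ u : WithOne S, (x : WithOne S) = y * u) ∧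
      ((∃ u : WithOne S, (y : WithOne S) = u * x) ∧ ∃ u : WithOne S, (x : WithOne S) = u * y) := by
  unfold GreenH
  simp only [insert_right_multiples_eq, insert_left_multiples_eq]
  constructor
  · rintro ⟨hr, hl⟩
    have hyr := hr.symm.subset (show y ∈ _ from ⟨1, (mul_one _).symm⟩)
    have hxr := hr.subset (show x ∈ _ from ⟨1, (mul_one _).symm⟩)
    have hyl := hl.symm.subset (show y ∈ _ from ⟨1, (one_mul _).symm⟩)
    have hxl := hl.subset (show x ∈ _ from ⟨1, (one_mul _).symm⟩)
    exact ⟨⟨hyr, hxr⟩, hyl, hxl⟩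
  · rintro ⟨⟨⟨a, ha⟩, b, hb⟩, ⟨c, hc⟩, d, hd⟩
    refine ⟨Set.Subset.antisymm ?_ ?_, Set.Subset.antisymm ?_ ?_⟩ <;> rintro z ⟨u, hu⟩
    · exact ⟨b * u, by rw [hu, hb, mul_assoc]⟩
    · exact ⟨a * u, by rw [hu, ha, mul_assoc]⟩
    · exact ⟨u * d, by rw [hu, hd, mul_assoc]⟩
    · exact ⟨u * c, by rw [hu, hc, mul_assoc]⟩

lemma mem_hClass_self {S : Type*} [Semigroup S] (x : S) : x ∈ HClass x := ⟨rfl, rfl⟩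

lemma greenH_of_mem_hClass {S : Type*} [Semigroup S] {x y z : S} (hy : y ∈ HClass x)
    (hz : z ∈ HClass x) : GreenH y z :=
  ⟨hy.1.symm.trans hz.1, hy.2.symm.trans hz.2⟩

lemma exists_eq_mul_right_of_mem_hClass {S : Type*} [Semigroup S] {x y z : S}
    (hy : y ∈ HClass x) (hz : z ∈ HClass x) : ∃ u : WithOne S, (z : WithOne S) = y * u :=
  ((greenH_iff y z).1 (greenH_of_mem_hClass hy hz)).1.1

lemma exists_eq_mul_left_of_mem_hClass {S : Type*} [Semigroup S] {x y z : S}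
    (hy : y ∈ HClass x) (hz : z ∈ HClass x) : ∃ u : WithOne S, (z : WithOne S) = u * y :=
  ((greenH_iff y z).1 (greenH_of_mem_hClass hy hz)).2.1

/-- An element that is `R`-related to one member of an `H`-class and `L`-related to another
belongs to that `H`-class. -/
lemma mem_hClass_of_mul_eq {S : Type*} [Semigroup S] {x y y' z : S} (hy : y ∈ HClass x)
    (hy' : y' ∈ HClass x) {a b c d : WithOne S} (ha : (z : WithOne S) = y * a)
    (hb : (y : WithOne S) = z * b) (hc : (z : WithOne S) = c * y')
    (hd : (y' : WithOne S) = d * z) : z ∈ HClass x := by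
  obtain ⟨u, hu⟩ := exists_eq_mul_left_of_mem_hClass hy hy'
  obtain ⟨v, hv⟩ := exists_eq_mul_left_of_mem_hClass hy' hy
  have hyz : GreenH y z := (greenH_iff y z).2
    ⟨⟨⟨a, ha⟩, b, hb⟩, ⟨c * u, by rw [hc, hu, mul_assoc]⟩, v * d, by rw [hv, hd, mul_assoc]⟩
  exact ⟨hy.1.trans hyz.1, hy.2.trans hyz.2⟩

lemma exists_coe_eq_coe_mul {S : Type*} [Semigroup S] (y : S) (s : WithOne S) :
    ∃ z : S, (z : WithOne S) = y * s := by
  cases s with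
  | one => exact ⟨y, (mul_one _).symm⟩
  | coe s => exact ⟨y * s, by simp⟩

/-- If right multiplication by `s` sends one member of an `H`-class back into it,
then it does so for every member. -/
lemma exists_mem_hClass_eq_mul {S : Type*} [Semigroup S] {x y z : S} {s : WithOne S}
    (hy : y ∈ HClass x) (hz : z ∈ HClass x) (hs : (z : WithOne S) = y * s) {y' : S}
    (hy' : y' ∈ HClass x) : ∃ z' ∈ HClass x, (z' : WithOne S) = y' * s := by
  obtain ⟨z', hz'⟩ := exists_coe_eq_coe_mul y' s
  obtain ⟨u, hu⟩ := exists_eq_mul_left_of_mem_hClass hy hy'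
  obtain ⟨w, hw⟩ := exists_eq_mul_left_of_mem_hClass hy' hy
  obtain ⟨v, hv⟩ := exists_eq_mul_right_of_mem_hClass hz hy
  refine ⟨z', mem_hClass_of_mul_eq hy' hz hz' (b := v) (c := u) (d := w) ?_ ?_ ?_, hz'⟩
  · rw [hz', hu, mul_assoc u, ← hs, mul_assoc, ← hv]
  · rw [hz', hu, hs, mul_assoc]
  · rw [hz', hs, hw, mul_assoc]

/-- Green's lemma: right multiplication by `s` permutes an `H`-class as soon as it sends one
member of the class back into it. -/
lemma mem_schStab_of_mul_eq {S : Type*} [Semigroup S] {x y z : S} {s : WithOne S}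
    (hy : y ∈ HClass x) (hz : z ∈ HClass x) (hs : (z : WithOne S) = y * s) :
    s ∈ SchStab (HClass x) := by
  change (fun h => h * s) '' ((fun x : S => (x : WithOne S)) '' HClass x)
    = (fun x : S => (x : WithOne S)) '' HClass x
  apply Set.Subset.antisymm
  · rintro _ ⟨_, ⟨y', hy', rfl⟩, rfl⟩
    exact exists_mem_hClass_eq_mul hy hz hs hy'
  · rintro _ ⟨y', hy', rfl⟩
    obtain ⟨v, hv⟩ := exists_eq_mul_right_of_mem_hClass hz hy
    obtain ⟨z', hz', hv'⟩ := exists_mem_hClass_eq_mul hz hy hv hy'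
    obtain ⟨w, hw⟩ := exists_eq_mul_left_of_mem_hClass hz hy'
    refine ⟨z', ⟨z', hz', rfl⟩, ?_⟩
    change (z' : WithOne S) * s = y'
    rw [hv', hw, mul_assoc w, ← hv, mul_assoc, ← hs]

lemma exists_mem_eq_mul_of_mem_schStab {S : Type*} [Semigroup S] {H : Set S} {y : S}
    (hy : y ∈ H) (s : SchStab H) : ∃ z ∈ H, (z : WithOne S) = y * (s : WithOne S) :=
  Eq.subset s.2 ⟨(y : WithOne S), ⟨y, hy, rfl⟩, rfl⟩

/-- If a member of an `H`-class begins and ends with a product of two members,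
then the square of every member lies in the class. -/
lemma mul_self_mem_hClass {S : Type*} [Semigroup S] {x y h a b a' b' : S} {c d : WithOne S}
    (hy : y ∈ HClass x) (hh : h ∈ HClass x) (ha : a ∈ HClass x) (hb : b ∈ HClass x)
    (ha' : a' ∈ HClass x) (hb' : b' ∈ HClass x) (hc : (y : WithOne S) = a * b * c)
    (hd : (y : WithOne S) = d * (a' * b')) : h * h ∈ HClass x := by
  obtain ⟨u, hu⟩ := exists_eq_mul_right_of_mem_hClass hh hb
  obtain ⟨v, hv⟩ := exists_eq_mul_left_of_mem_hClass ha hh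
  obtain ⟨p, hp⟩ := exists_eq_mul_right_of_mem_hClass hy ha
  obtain ⟨q, hq⟩ := exists_eq_mul_left_of_mem_hClass hy hb'
  obtain ⟨r, hr⟩ := exists_eq_mul_right_of_mem_hClass hb' hh
  obtain ⟨k, hk⟩ := exists_eq_mul_left_of_mem_hClass hh ha'
  refine mem_hClass_of_mul_eq hh hh (a := h) (b := u * c * p) (c := h) (d := q * d * k)
    (WithOne.coe_mul h h) ?_ (WithOne.coe_mul h h) ?_
  · calc (h : WithOne S) = v * a := hv
      _ = v * (a * b * c * p) := by rw [← hc, ← hp]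
      _ = (v * a) * b * c * p := by simp only [mul_assoc]
      _ = h * (h * u) * c * p := by rw [← hv, ← hu]
      _ = _ := by rw [WithOne.coe_mul]; simp only [mul_assoc]
  · calc (h : WithOne S) = b' * r := hr
      _ = q * (d * (a' * b')) * r := by rw [← hd, ← hq]
      _ = q * d * a' * (b' * r) := by simp only [mul_assoc]
      _ = q * d * (k * h) * h := by rw [← hr, ← hk]
      _ = _ := by rw [WithOne.coe_mul]; simp only [mul_assoc]

lemma IsSchutzenbergerGroup.map_eq_of_mul_eq {S : Type*} [Semigroup S] {x : S} {Γ : Type*}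
    [Group Γ] {φ : SchStab (HClass x) →* Γ} (hφ : IsSchutzenbergerGroup (HClass x) Γ φ)
    {y : S} (hy : y ∈ HClass x) {s t : SchStab (HClass x)}
    (hst : (y : WithOne S) * (s : WithOne S) = y * (t : WithOne S)) : φ s = φ t := by
  rw [hφ.2]
  intro h hh
  obtain ⟨u, hu⟩ := exists_eq_mul_left_of_mem_hClass hy hh
  rw [hu, mul_assoc, hst, mul_assoc]

/-- If `h * h` lies in the `H`-class of `h`, then the class contains an element acting as a
right identity on it. -/
lemma IsSchutzenbergerGroup.exists_right_identity {S : Type*} [Semigroup S] {x : S} {Γ : Type*}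
    [Group Γ] {φ : SchStab (HClass x) →* Γ} (hφ : IsSchutzenbergerGroup (HClass x) Γ φ)
    {h : S} (hh : h ∈ HClass x) (hmul : h * h ∈ HClass x) :
    ∃ e ∈ HClass x, ∀ y ∈ HClass x, y * e = y := by
  let k : SchStab (HClass x) := ⟨h, mem_schStab_of_mul_eq hh hmul (WithOne.coe_mul h h)⟩
  obtain ⟨u, hu⟩ := hφ.1 (φ k)⁻¹
  obtain ⟨e, he, heq⟩ := exists_mem_eq_mul_of_mem_schStab hh u
  have hku : φ (k * u) = φ 1 := by simp [hu]
  refine ⟨e, he, fun y hy => ?_⟩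
  have hact : (y : WithOne S) * (h * u) = y * 1 := (hφ.2 _ _).1 hku y hy
  rw [← heq, mul_one] at hact
  exact_mod_cast hact

/-- Every subsemigroup of the Schützenberger group is cut out, through the orbit of a suitable
base point of the `H`-class, by a subsemigroup of the ambient semigroup. -/
lemma IsSchutzenbergerGroup.exists_subsemigroup {S : Type*} [Semigroup S] {x : S} {Γ : Type*}
    [Group Γ] {φ : SchStab (HClass x) →* Γ} (hφ : IsSchutzenbergerGroup (HClass x) Γ φ)
    (T : Subsemigroup Γ) :
    ∃ h ∈ HClass x, ∃ T' : Subsemigroup S, ∀ (s : SchStab (HClass x)) (z : S),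
      (z : WithOne S) = h * (s : WithOne S) → (z ∈ T' ↔ φ s ∈ T) := by
  by_cases hx : x * x ∈ HClass x
  · obtain ⟨e, he, hid⟩ := hφ.exists_right_identity (mem_hClass_self x) hx
    refine ⟨e, he, ⟨{z | ∃ s, φ s ∈ T ∧ (z : WithOne S) = e * (s : WithOne S)}, ?_⟩, ?_⟩
    · rintro y z ⟨s, hs, hy⟩ ⟨t, ht, hz⟩
      refine ⟨s * t, by rw [map_mul]; exact T.mul_mem hs ht, ?_⟩
      obtain ⟨y', hy', hyy'⟩ := exists_mem_eq_mul_of_mem_schStab he s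
      obtain rfl : y = y' := WithOne.coe_inj.1 (hy.trans hyy'.symm)
      rw [WithOne.coe_mul, hz, ← mul_assoc, ← WithOne.coe_mul, hid y hy', hy, mul_assoc]
      rfl
    · rintro s z hz
      constructor
      · rintro ⟨t, ht, hzt⟩
        rwa [hφ.map_eq_of_mul_eq he (hz.symm.trans hzt)]
      · exact fun hs => ⟨s, hs, hz⟩
  · let A : Set S := {z | ∃ s, φ s ∈ T ∧ (z : WithOne S) = x * (s : WithOne S)}
    have hA : A ⊆ HClass x := by
      rintro z ⟨s, -, hz⟩
      obtain ⟨z', hz', hzz'⟩ := exists_mem_eq_mul_of_mem_schStab (mem_hClass_self x) s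
      rwa [WithOne.coe_inj.1 (hz.trans hzz'.symm)]
    refine ⟨x, mem_hClass_self x, ⟨{z | z ∈ A ∨
      (∃ a ∈ HClass x, ∃ b ∈ HClass x, ∃ c : WithOne S, (z : WithOne S) = a * b * c) ∧
      (∃ a ∈ HClass x, ∃ b ∈ HClass x, ∃ d : WithOne S, (z : WithOne S) = d * (a * b))}, ?_⟩, ?_⟩
    · intro y z hy hz
      refine Or.inr ⟨?_, ?_⟩
      · rcases hy with hy | ⟨⟨a, ha, b, hb, c, hc⟩, -⟩
        · rcases hz with hz | ⟨⟨a, ha, b, hb, c, hc⟩, -⟩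
          · exact ⟨y, hA hy, z, hA hz, 1, by simp⟩
          · exact ⟨y, hA hy, a, ha, b * c, by simp only [WithOne.coe_mul, hc, mul_assoc]⟩
        · exact ⟨a, ha, b, hb, c * z, by simp only [WithOne.coe_mul, hc, mul_assoc]⟩
      · rcases hz with hz | ⟨-, a, ha, b, hb, d, hd⟩
        · rcases hy with hy | ⟨-, a, ha, b, hb, d, hd⟩
          · exact ⟨y, hA hy, z, hA hz, 1, by simp⟩
          · exact ⟨b, hb, z, hA hz, d * a, by simp only [WithOne.coe_mul, hd, mul_assoc]⟩
        · exact ⟨a, ha, b, hb, y * d, by simp only [WithOne.coe_mul, hd, mul_assoc]⟩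
    · intro s z hz
      constructor
      · rintro (⟨t, ht, hzt⟩ | ⟨⟨a, ha, b, hb, c, hc⟩, a', ha', b', hb', d, hd⟩)
        · rwa [hφ.map_eq_of_mul_eq (mem_hClass_self x) (hz.symm.trans hzt)]
        · obtain ⟨z', hz', hzz'⟩ := exists_mem_eq_mul_of_mem_schStab (mem_hClass_self x) s
          obtain rfl : z = z' := WithOne.coe_inj.1 (hz.trans hzz'.symm)
          exact absurd (mul_self_mem_hClass hz' (mem_hClass_self x) ha hb ha' hb' hc hd) hx
      · exact fun hs => Or.inl ⟨s, hs, hz⟩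

/-- A homomorphism `f` from `S` induces a homomorphism from the Schützenberger group of `H` to
the opposite of the monoid of self-maps of `f(H)`. -/
lemma IsSchutzenbergerGroup.exists_hom_end {S : Type*} [Semigroup S] {x : S} {Γ : Type*}
    [Group Γ] {φ : SchStab (HClass x) →* Γ} (hφ : IsSchutzenbergerGroup (HClass x) Γ φ)
    {U : Type*} [Semigroup U] (f : S →ₙ* U) :
    ∃ F : Γ →ₙ* (Function.End (f '' HClass x))ᵐᵒᵖ,
      ∀ (s : SchStab (HClass x)) (y : S) (hy : y ∈ HClass x) (z : S),
        (z : WithOne S) = y * (s : WithOne S) →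
          ((F (φ s)).unop ⟨f y, y, hy, rfl⟩ : U) = f z := by
  choose r hr using hφ.1
  choose g hg hfg using fun u : (f '' HClass x) => u.2
  choose a ha hya using fun (y : HClass x) (s : SchStab (HClass x)) =>
    exists_mem_eq_mul_of_mem_schStab y.2 s
  let E : Γ → Function.End (f '' HClass x) := fun γ u => ⟨f (a ⟨g u, hg u⟩ (r γ)), _, ha _ _, rfl⟩
  have hE : ∀ (s : SchStab (HClass x)) (u : f '' HClass x) (y z : S), y ∈ HClass x →
      f y = u → (z : WithOne S) = y * (s : WithOne S) → (E (φ s) u : U) = f z := by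
    intro s u y z hy hyu hz
    change f (a ⟨g u, hg u⟩ (r (φ s))) = f z
    have h1 : (a ⟨g u, hg u⟩ (r (φ s)) : WithOne S) = g u * (s : WithOne S) :=
      (hya _ _).trans ((hφ.2 _ _).1 (hr (φ s)) (g u) (hg u))
    have hgu : f (g u) = f y := (hfg u).trans hyu.symm
    generalize a ⟨g u, hg u⟩ (r (φ s)) = w at h1
    generalize (s : WithOne S) = t at h1 hz
    cases t with
    | one =>
      rw [mul_one] at h1 hz
      rw [WithOne.coe_inj.1 h1, WithOne.coe_inj.1 hz, hgu]
    | coe t =>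
      rw [← WithOne.coe_mul] at h1 hz
      rw [WithOne.coe_inj.1 h1, WithOne.coe_inj.1 hz, map_mul, map_mul, hgu]
  refine ⟨⟨fun γ => MulOpposite.op (E γ), fun γ δ => ?_⟩, fun s y hy z hz => hE s _ y z hy rfl hz⟩
  rw [← MulOpposite.op_mul]
  congr 1
  funext u
  apply Subtype.ext
  obtain ⟨s, rfl⟩ := hφ.1 γ
  obtain ⟨t, rfl⟩ := hφ.1 δ
  let y : HClass x := ⟨g u, hg u⟩
  have h1 : (E (φ s) u : U) = f (a y s) := hE s u (g u) _ (hg u) (hfg u) (hya y s)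
  change (E (φ s * φ t) u : U) = E (φ t) (E (φ s) u)
  rw [hE t _ (a y s) (a ⟨a y s, ha y s⟩ t) (ha y s) h1.symm (hya ⟨a y s, ha y s⟩ t), ← map_mul]
  refine hE (s * t) u (g u) _ (hg u) (hfg u) ?_
  rw [hya ⟨a y s, ha y s⟩ t, hya y s, mul_assoc]
  rfl

theorem schutzenberger_strongly_separable (S : Type*) [Semigroup S]
    (hS : IsStronglySubsemigroupSeparable S) (x : S)
    (Γ : Type*) [Group Γ] (φ : SchStab (HClass x) →* Γ)
    (hφ : IsSchutzenbergerGroup (HClass x) Γ φ) :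
    IsStronglySubsemigroupSeparable Γ := by
  intro T γ hγ
  obtain ⟨h, hh, T', hT'⟩ := hφ.exists_subsemigroup T
  obtain ⟨s, rfl⟩ := hφ.1 γ
  obtain ⟨z, -, hzs⟩ := exists_mem_eq_mul_of_mem_schStab hh s
  obtain ⟨U, _, _, f, hf⟩ := hS T' z fun hz => hγ ((hT' s z hzs).1 hz)
  obtain ⟨F, hF⟩ := hφ.exists_hom_end f
  have : Finite (Function.End (f '' HClass x)) :=
    inferInstanceAs (Finite (f '' HClass x → f '' HClass x))
  refine ⟨(Function.End (f '' HClass x))ᵐᵒᵖ, inferInstance,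
    Finite.of_equiv _ MulOpposite.opEquiv, F, ?_⟩
  rintro ⟨δ, hδ, hFδ⟩
  obtain ⟨t, rfl⟩ := hφ.1 δ
  obtain ⟨w, -, hwt⟩ := exists_mem_eq_mul_of_mem_schStab hh t
  refine hf ⟨w, (hT' t w hwt).2 hδ, ?_⟩
  rw [← hF t h hh w hwt, ← hF s h hh z hzs, hFδ]
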